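/- Let m, n ≥ 2 and p ≥ 1 be integers. Set r_j = cos(jπ/(m−1)) for 0 ≤ j < m, z_k = cos(kπ/(n−1)) for 0 ≤ k < n, and θ_ℓ = (2ℓ − p)π/p for 0 ≤ ℓ < p. Then for every array of values a : (Fin m) × (Fin n) × (Fin p) → ℂ there exists a unique array of coefficients c : (Fin m) × (Fin n) × (Fin p) → ℂ such that for all (j', k', ℓ'), Σ_{j,k,ℓ} c(j,k,ℓ) · T_j(r_{j'}) · T_k(z_{k'}) · exp(i(ℓ − ⌊p/2⌋)θ_{ℓ'}) = a(j',k',ℓ'), where T_K is the degree-K Chebyshev polynomial of the first kind. That is, every assignment of data on the coordinate grid has a unique interpolant in the span of the Chebyshev–Chebyshev–Fourier basis functions T_j(r)T_k(z)e^{i(ℓ−⌊p/2⌋)θ}. -/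

import Mathlib

open Polynomial Real

open scoped Kronecker in
theorem Matrix.isUnit_kronecker {ι κ K : Type*} [Fintype ι] [Fintype κ] [DecidableEq ι]
    [DecidableEq κ] [CommRing K] {A : Matrix ι ι K} {B : Matrix κ κ K}
    (hA : IsUnit A) (hB : IsUnit B) : IsUnit (A ⊗ₖ B) := by
  rw [Matrix.isUnit_iff_isUnit_det] at *
  rw [Matrix.det_kronecker]
  exact (hA.pow _).mul (hB.pow _)

theorem Matrix.existsUnique_mulVec_eq {ι K : Type*} [Fintype ι] [DecidableEq ι] [CommRing K]
    {A : Matrix ι ι K} (hA : IsUnit A) (b : ι → K) : ∃! x, A.mulVec x = b := by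
  obtain ⟨u, rfl⟩ := hA
  refine ⟨(↑u⁻¹ : Matrix ι ι K).mulVec b, by simp, ?_⟩
  rintro x rfl
  simp

/-- Polynomials of degrees `0, …, n - 1` have an invertible collocation matrix at distinct nodes. -/
theorem Matrix.isUnit_of_eval {K : Type*} [Field K] {n : ℕ} {v : Fin n → K}
    (hv : Function.Injective v) (q : Fin n → K[X]) (hdeg : ∀ j, (q j).degree = (j : ℕ)) :
    IsUnit (Matrix.of fun i j => (q j).eval (v i)) := by
  have hnat : ∀ j, (q j).natDegree = j := fun j => natDegree_eq_of_degree_eq_some (hdeg j)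
  rw [Matrix.isUnit_iff_isUnit_det, isUnit_iff_ne_zero,
    Matrix.eval_matrixOfPolynomials_eq_vandermonde_mul_matrixOfPolynomials v q
      fun j => (hnat j).le, Matrix.det_mul,
    Matrix.det_of_isUpperTriangular
      (Matrix.matrixOfPolynomials_blockTriangular q fun j => (hnat j).le)]
  refine mul_ne_zero (Matrix.det_vandermonde_ne_zero_iff.mpr hv)
    (Finset.prod_ne_zero_iff.mpr fun j _ => ?_)
  exact coeff_ne_zero_of_eq_degree (hdeg j)

theorem cos_mul_pi_div_sub_one_injective {n : ℕ} (hn : 2 ≤ n) :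
    Function.Injective fun j : Fin n => Real.cos ((j : ℕ) * Real.pi / ((n : ℝ) - 1)) := by
  have hn' : (0 : ℝ) < n - 1 := by
    have : (2 : ℝ) ≤ n := mod_cast hn
    linarith
  have hmem : ∀ j : Fin n, (j : ℕ) * Real.pi / ((n : ℝ) - 1) ∈ Set.Icc 0 Real.pi := by
    intro j
    refine ⟨by positivity, ?_⟩
    have hj : ((j : ℕ) : ℝ) ≤ n - 1 := by
      have : ((j : ℕ) : ℝ) + 1 ≤ n := mod_cast j.isLt
      linarith
    rw [div_le_iff₀ hn', mul_comm]
    gcongr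
  intro i j hij
  have h := Real.injOn_cos (hmem i) (hmem j) hij
  rw [div_left_inj' hn'.ne', mul_left_inj' Real.pi_ne_zero] at h
  exact Fin.ext (mod_cast h)

theorem isUnit_chebyshev_collocation {n : ℕ} (hn : 2 ≤ n) :
    IsUnit (Matrix.of fun i j : Fin n => (Chebyshev.T ℂ ((j : ℕ) : ℤ)).eval
      ((Real.cos ((i : ℕ) * Real.pi / ((n : ℝ) - 1)) : ℝ) : ℂ)) :=
  Matrix.isUnit_of_eval (Complex.ofReal_injective.comp (cos_mul_pi_div_sub_one_injective hn))
    (fun j : Fin n => Chebyshev.T ℂ ((j : ℕ) : ℤ)) fun j => by simp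

theorem exp_I_mul_grid_injective {p : ℕ} (hp : p ≠ 0) :
    Function.Injective fun l : Fin p =>
      Complex.exp (Complex.I * (((2 * ((l : ℕ) : ℝ) - (p : ℝ)) * Real.pi / (p : ℝ) : ℝ) : ℂ)) := by
  have hp' : (p : ℂ) ≠ 0 := mod_cast hp
  have key : ∀ l : Fin p,
      Complex.exp (Complex.I * (((2 * ((l : ℕ) : ℝ) - (p : ℝ)) * Real.pi / (p : ℝ) : ℝ) : ℂ)) =
        Complex.exp (2 * Real.pi * Complex.I / p) ^ (l : ℕ) *
          Complex.exp (-(Real.pi * Complex.I)) := by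
    intro l
    rw [← Complex.exp_nat_mul, ← Complex.exp_add]
    congr 1
    push_cast
    field_simp
    ring
  intro i j hij
  simp only [key] at hij
  exact Fin.ext ((Complex.isPrimitiveRoot_exp p hp).pow_inj i.isLt j.isLt
    (mul_right_cancel₀ (Complex.exp_ne_zero _) hij))

/-- The Fourier collocation matrix on `p` equispaced angles, with frequencies shifted by `s`,
is invertible. -/
theorem isUnit_fourier_collocation {p : ℕ} (hp : p ≠ 0) (s : ℂ) :
    IsUnit (Matrix.of fun i j : Fin p =>
      Complex.exp (Complex.I * (((j : ℕ) : ℂ) - s) *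
        (((2 * ((i : ℕ) : ℝ) - (p : ℝ)) * Real.pi / (p : ℝ) : ℝ) : ℂ))) := by
  set θ : Fin p → ℂ := fun i => (((2 * ((i : ℕ) : ℝ) - (p : ℝ)) * Real.pi / (p : ℝ) : ℝ) : ℂ)
  have hinj : Function.Injective fun i => Complex.exp (Complex.I * θ i) :=
    exp_I_mul_grid_injective hp
  have heq : (Matrix.of fun i j : Fin p =>
      Complex.exp (Complex.I * (((j : ℕ) : ℂ) - s) * θ i)) =
      Matrix.diagonal (fun i => Complex.exp (-(Complex.I * s * θ i))) *
        Matrix.vandermonde fun i => Complex.exp (Complex.I * θ i) := by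
    ext i j
    rw [Matrix.diagonal_mul, Matrix.vandermonde_apply, ← Complex.exp_nat_mul, ← Complex.exp_add,
      Matrix.of_apply]
    congr 1
    ring
  rw [heq, Matrix.isUnit_iff_isUnit_det, isUnit_iff_ne_zero, Matrix.det_mul, Matrix.det_diagonal]
  exact mul_ne_zero (Finset.prod_ne_zero_iff.mpr fun _ _ => Complex.exp_ne_zero _)
    (Matrix.det_vandermonde_ne_zero_iff.mpr hinj)

/-- On the doubled m×n×p Chebyshev–Chebyshev–Fourier grid with
`r_j = cos(jπ/(m−1))`, `z_k = cos(kπ/(n−1))`, `θ_ℓ = (2ℓ−p)π/p`, every array of values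
`a` on the grid has a unique array of coefficients `c` with
`Σ_{j,k,ℓ} c(j,k,ℓ)·T_j(r_{j'})·T_k(z_{k'})·exp(i(ℓ−⌊p/2⌋)θ_{ℓ'}) = a(j',k',ℓ')`
for all grid indices `(j',k',ℓ')`. -/
theorem ccf_interpolation_exists_unique (m n p : ℕ) (hm : 2 ≤ m) (hn : 2 ≤ n) (hp : 1 ≤ p)
    (a : Fin m × Fin n × Fin p → ℂ) :
    ∃! c : Fin m × Fin n × Fin p → ℂ,
      ∀ (j' : Fin m) (k' : Fin n) (l' : Fin p),
        (∑ idx : Fin m × Fin n × Fin p,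
          c idx *
            (Chebyshev.T ℂ ((idx.1 : ℕ) : ℤ)).eval
              ((Real.cos ((j' : ℕ) * Real.pi / ((m : ℝ) - 1)) : ℝ) : ℂ) *
            (Chebyshev.T ℂ ((idx.2.1 : ℕ) : ℤ)).eval
              ((Real.cos ((k' : ℕ) * Real.pi / ((n : ℝ) - 1)) : ℝ) : ℂ) *
            Complex.exp (Complex.I * (((idx.2.2 : ℕ) : ℂ) - ((p / 2 : ℕ) : ℂ)) *
              (((2 * ((l' : ℕ) : ℝ) - (p : ℝ)) * Real.pi / (p : ℝ) : ℝ) : ℂ)))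
          = a (j', k', l') := by
  have hunit := Matrix.isUnit_kronecker (isUnit_chebyshev_collocation hm)
    (Matrix.isUnit_kronecker (isUnit_chebyshev_collocation hn)
      (isUnit_fourier_collocation (Nat.one_le_iff_ne_zero.mp hp) ((p / 2 : ℕ) : ℂ)))
  convert Matrix.existsUnique_mulVec_eq hunit a using 2 with c
  simp only [funext_iff, Prod.forall]
  refine forall_congr' fun j' => forall_congr' fun k' => forall_congr' fun l' => ?_
  rw [Matrix.mulVec, dotProduct]
  refine Eq.congr (Finset.sum_congr rfl fun idx _ => ?_) rfl
  simp only [Matrix.kroneckerMap_apply, Matrix.of_apply]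
  ring
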